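/- Let N ≥ 2, 0 < s < 1 < p, N > sp, and t, m ≥ 0 with m ≤ p − 1. Let θ > 0 and θ̄ ∈ (0, min{sp/(p−1), 1}) satisfy (θ̄ − 1)(p − 1 − m) + p − 1 − sp + t θ < 0. For ε ∈ (0,1) define φ_ε : ℝ^N → ℝ by φ_ε(x) = −ε |x|^{θ̄}. Then for every κ > 0 there exists r_κ ≥ 1 such that for every ε ∈ (0,1) and every x ∈ ℝ^N with |x| ≥ r_κ, the fractional p-Laplacian (−Δ_p)^s φ_ε(x) exists in the principal-value sense with a value strictly less than κ |x|^{−tθ} (ε θ̄ |x|^{θ̄ − 1})^m. -/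

import Mathlib

open MeasureTheory Filter Set

/-- `(-Δ_p)^s u(x)` exists in the principal-value sense with value `L`:
for every `r > 0` the integrand is integrable on `{y : |x - y| > r}`, and the
truncated integrals converge to `L` as `r → 0⁺`. -/
noncomputable def pvFracPLap (N : ℕ) (s p : ℝ) (u : EuclideanSpace ℝ (Fin N) → ℝ)
    (x : EuclideanSpace ℝ (Fin N)) (L : ℝ) : Prop :=
  (∀ r : ℝ, 0 < r →
    IntegrableOn
      (fun y => |u x - u y| ^ (p - 2) * (u x - u y) * ‖x - y‖ ^ (-((N : ℝ) + s * p)))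
      {y | r < ‖x - y‖} volume) ∧
  Tendsto
    (fun r : ℝ => ∫ y in {y : EuclideanSpace ℝ (Fin N) | r < ‖x - y‖},
        |u x - u y| ^ (p - 2) * (u x - u y) * ‖x - y‖ ^ (-((N : ℝ) + s * p)))
    (nhdsWithin 0 (Set.Ioi 0)) (nhds L)

/-- The odd power `a ↦ |a|^(p-2) a`. -/
noncomputable def oddPow (p a : ℝ) : ℝ := |a| ^ (p - 2) * a

lemma oddPow_neg (p a : ℝ) : oddPow p (-a) = -oddPow p a := by
  simp [oddPow]

lemma oddPow_mul (p a b : ℝ) : oddPow p (a * b) = oddPow p a * oddPow p b := by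
  unfold oddPow
  rw [abs_mul, Real.mul_rpow (abs_nonneg _) (abs_nonneg _)]
  ring

lemma abs_oddPow {p : ℝ} (hp : 1 < p) (a : ℝ) : |oddPow p a| = |a| ^ (p - 1) := by
  unfold oddPow
  rw [abs_mul, abs_of_nonneg (Real.rpow_nonneg (abs_nonneg a) _)]
  rcases eq_or_ne a 0 with rfl | ha
  · simp [Real.zero_rpow (by linarith : p - 1 ≠ 0)]
  · rw [show p - 1 = (p - 2) + 1 by ring, Real.rpow_add_one (abs_ne_zero.2 ha)]

lemma oddPow_of_nonneg {p : ℝ} (hp : 1 < p) {a : ℝ} (ha : 0 ≤ a) : oddPow p a = a ^ (p - 1) := by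
  have h := abs_oddPow hp a
  rwa [abs_of_nonneg ha, abs_of_nonneg] at h
  unfold oddPow
  positivity

lemma oddPow_of_nonpos {p : ℝ} (hp : 1 < p) {a : ℝ} (ha : a ≤ 0) :
    oddPow p a = -(-a) ^ (p - 1) := by
  rw [← oddPow_of_nonneg hp (neg_nonneg.2 ha), oddPow_neg, neg_neg]

@[fun_prop]
lemma measurable_oddPow (p : ℝ) : Measurable (oddPow p) := by
  unfold oddPow
  fun_prop

lemma abs_oddPow_sub_one_le {p : ℝ} (hp : 1 < p) (hp2 : p ≤ 2) (t : ℝ) :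
    |oddPow p t - 1| ≤ 2 * |t - 1| := by
  rcases le_total 0 t with ht | ht
  · rw [oddPow_of_nonneg hp ht]
    rcases le_total 1 t with h1 | h1
    · have ha := Real.one_le_rpow h1 (by linarith : 0 ≤ p - 1)
      have hb := Real.rpow_le_rpow_of_exponent_le h1 (by linarith : p - 1 ≤ 1)
      rw [Real.rpow_one] at hb
      rw [abs_of_nonneg (by linarith), abs_of_nonneg (by linarith)]
      linarith
    · have ha := Real.rpow_le_one ht h1 (by linarith : 0 ≤ p - 1)
      have hb : t ≤ t ^ (p - 1) := Real.self_le_rpow_of_le_one ht h1 (by linarith)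
      rw [abs_of_nonpos (by linarith), abs_of_nonpos (by linarith)]
      linarith
  · rw [oddPow_of_nonpos hp ht]
    have ha : (-t) ^ (p - 1) ≤ 1 + -t := by
      have := Real.rpow_le_rpow (by linarith) (by linarith : -t ≤ 1 + -t)
        (by linarith : 0 ≤ p - 1)
      refine this.trans ?_
      have hb := Real.rpow_le_rpow_of_exponent_le (by linarith : 1 ≤ 1 + -t)
        (by linarith : p - 1 ≤ 1)
      rwa [Real.rpow_one] at hb
    have hc := Real.rpow_nonneg (neg_nonneg.2 ht) (p - 1)
    rw [abs_of_nonpos (by linarith), abs_of_nonpos (by linarith)]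
    linarith

lemma abs_oddPow_sub_one_le_of_two_le {p : ℝ} (hp : 2 ≤ p) {t : ℝ} (ht1 : |t| ≤ 1) :
    |oddPow p t - 1| ≤ (p - 1) * |t - 1| := by
  obtain ⟨hl, hu⟩ := abs_le.1 ht1
  rcases le_total 0 t with ht | ht
  · rw [oddPow_of_nonneg (by linarith) ht]
    have ha := Real.rpow_le_one ht hu (by linarith : 0 ≤ p - 1)
    have hb := one_add_mul_self_le_rpow_one_add (s := t - 1) (by linarith)
      (by linarith : 1 ≤ p - 1)
    rw [add_sub_cancel] at hb
    rw [abs_of_nonpos (by linarith), abs_of_nonpos (by linarith)]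
    linarith
  · rw [oddPow_of_nonpos (by linarith) ht]
    have ha : (-t) ^ (p - 1) ≤ -t := by
      simpa using Real.rpow_le_rpow_of_exponent_ge_of_imp (by linarith : 0 ≤ -t)
        (by linarith : -t ≤ 1) (by linarith : 1 ≤ p - 1) (by intro _ h; linarith)
    have hc := Real.rpow_nonneg (neg_nonneg.2 ht) (p - 1)
    rw [abs_of_nonpos (by linarith), abs_of_nonpos (by linarith)]
    nlinarith

lemma abs_oddPow_sub_le {p : ℝ} (hp : 1 < p) (hp2 : p ≤ 2) (a : ℝ) {b : ℝ} (hb : b ≠ 0) :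
    |oddPow p a - oddPow p b| ≤ 2 * |a - b| * |b| ^ (p - 2) := by
  obtain ⟨t, rfl⟩ : ∃ t, a = t * b := ⟨a / b, by field_simp⟩
  have h1 : oddPow p (t * b) - oddPow p b = (oddPow p t - 1) * oddPow p b := by
    rw [oddPow_mul]; ring
  have h2 : t * b - b = (t - 1) * b := by ring
  have h3 : |oddPow p b| = |b| ^ (p - 2) * |b| := by
    unfold oddPow
    rw [abs_mul, abs_of_nonneg (Real.rpow_nonneg (abs_nonneg b) _)]
  rw [h1, h2, abs_mul, abs_mul, h3]
  have := mul_le_mul_of_nonneg_right (abs_oddPow_sub_one_le hp hp2 t)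
    (by positivity : 0 ≤ |b| ^ (p - 2) * |b|)
  linarith

lemma abs_oddPow_sub_le_of_two_le {p : ℝ} (hp : 2 ≤ p) {a b M : ℝ} (ha : |a| ≤ M)
    (hb : |b| ≤ M) : |oddPow p a - oddPow p b| ≤ (p - 1) * |a - b| * M ^ (p - 2) := by
  wlog hab : |a| ≤ |b| generalizing a b
  · rw [abs_sub_comm, abs_sub_comm a b]
    exact this hb ha (le_of_not_ge hab)
  rcases eq_or_ne b 0 with rfl | hb0
  · obtain rfl : a = 0 := by simpa using hab
    simp
  obtain ⟨t, rfl⟩ : ∃ t, a = t * b := ⟨a / b, by field_simp⟩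
  have ht : |t| ≤ 1 := by
    rw [abs_mul] at hab
    by_contra! h
    nlinarith [abs_pos.2 hb0]
  have h1 : oddPow p (t * b) - oddPow p b = (oddPow p t - 1) * oddPow p b := by
    rw [oddPow_mul]; ring
  have h2 : t * b - b = (t - 1) * b := by ring
  have h3 : |oddPow p b| = |b| ^ (p - 2) * |b| := by
    unfold oddPow
    rw [abs_mul, abs_of_nonneg (Real.rpow_nonneg (abs_nonneg b) _)]
  have h4 : |b| ^ (p - 2) ≤ M ^ (p - 2) :=
    Real.rpow_le_rpow (abs_nonneg b) hb (by linarith)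
  rw [h1, h2, abs_mul, abs_mul, h3]
  calc |oddPow p t - 1| * (|b| ^ (p - 2) * |b|)
      ≤ ((p - 1) * |t - 1|) * (M ^ (p - 2) * |b|) := by
        gcongr
        · exact mul_nonneg (by linarith) (abs_nonneg _)
        · exact abs_oddPow_sub_one_le_of_two_le hp ht
    _ = (p - 1) * (|t - 1| * |b|) * M ^ (p - 2) := by ring

/-- Second-order Taylor bound for `(1 + τ)^b`. -/
lemma abs_one_add_rpow_sub_le {b τ : ℝ} (hb0 : 0 ≤ b) (hb1 : b ≤ 1) (hτ : -1 < τ) :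
    |(1 + τ) ^ b - 1 - b * τ| ≤ τ ^ 2 := by
  have hu := rpow_one_add_le_one_add_mul_self hτ.le hb0 hb1
  have hl := rpow_one_add_le_one_add_mul_self hτ.le (sub_nonneg.2 hb1)
    (by linarith : 1 - b ≤ 1)
  have hpos : 0 < 1 + τ := by linarith
  have hx := Real.rpow_pos_of_pos hpos b
  have hy := Real.rpow_pos_of_pos hpos (1 - b)
  have hxy : (1 + τ) ^ b * (1 + τ) ^ (1 - b) = 1 + τ := by
    rw [← Real.rpow_add hpos, add_sub_cancel, Real.rpow_one]
  set X := (1 + τ) ^ b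
  set Y := (1 + τ) ^ (1 - b)
  have hZ : 0 < 1 + (1 - b) * τ := lt_of_lt_of_le hy hl
  have h1 : 1 + τ ≤ X * (1 + (1 - b) * τ) := by
    rw [← hxy]; gcongr
  rw [abs_of_nonpos (by linarith)]
  have h2 : (1 + b * τ - τ ^ 2) * (1 + (1 - b) * τ) ≤ 1 + τ := by
    have : 1 + τ - (1 + b * τ - τ ^ 2) * (1 + (1 - b) * τ)
        = τ ^ 2 * ((1 - b * (1 - b)) + (1 - b) * τ) := by ring
    have h3 : 0 ≤ (1 - b * (1 - b)) + (1 - b) * τ := by nlinarith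
    nlinarith [mul_nonneg (sq_nonneg τ) h3]
  have h4 := le_of_mul_le_mul_right (h2.trans h1) hZ
  linarith

lemma pow_finrank_sub_one_mul_rpow {E : Type*} [NormedAddCommGroup E] [NormedSpace ℝ E]
    [FiniteDimensional ℝ E] [Nontrivial E] {y : ℝ} (hy : 0 < y) (a : ℝ) :
    y ^ (Module.finrank ℝ E - 1) * y ^ a = y ^ ((Module.finrank ℝ E : ℝ) - 1 + a) := by
  have h1 : 1 ≤ Module.finrank ℝ E := Module.finrank_pos
  rw [Real.rpow_add hy, ← Real.rpow_natCast y, Nat.cast_sub h1, Nat.cast_one]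

section NormPowers

variable {E : Type*} [NormedAddCommGroup E] [NormedSpace ℝ E] [MeasurableSpace E] [BorelSpace E]
  [FiniteDimensional ℝ E] [Nontrivial E] (μ : Measure E) [μ.IsAddHaarMeasure]

lemma integrableOn_ball_norm_rpow {a : ℝ} (ha : -(Module.finrank ℝ E : ℝ) < a) :
    IntegrableOn (fun x : E => ‖x‖ ^ a) {x | ‖x‖ < 1} μ := by
  have key : Integrable (fun x : E => (Iio (1 : ℝ)).indicator (fun y => y ^ a) ‖x‖) μ := by
    rw [integrable_fun_norm_addHaar]
    have h : IntegrableOn (fun y : ℝ => y ^ ((Module.finrank ℝ E : ℝ) - 1 + a)) (Ioo 0 1) :=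
      (intervalIntegral.integrableOn_Ioo_rpow_iff one_pos).2 (by linarith)
    rw [← integrable_indicator_iff measurableSet_Ioi]
    rw [← integrable_indicator_iff measurableSet_Ioo] at h
    refine h.congr (Eventually.of_forall fun y => ?_)
    by_cases h0 : 0 < y <;> by_cases h1 : y < 1 <;>
      simp [indicator, h0, h1, pow_finrank_sub_one_mul_rpow (E := E)]
  rw [← integrable_indicator_iff (measurableSet_lt measurable_norm measurable_const)]
  exact key

lemma integrableOn_compl_ball_norm_rpow {a : ℝ} (ha : a < -(Module.finrank ℝ E : ℝ)) :
    IntegrableOn (fun x : E => ‖x‖ ^ a) {x | 1 ≤ ‖x‖} μ := by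
  have key : Integrable (fun x : E => (Ici (1 : ℝ)).indicator (fun y => y ^ a) ‖x‖) μ := by
    rw [integrable_fun_norm_addHaar]
    have h : IntegrableOn (fun y : ℝ => y ^ ((Module.finrank ℝ E : ℝ) - 1 + a)) (Ici 1) :=
      (integrableOn_Ici_iff_integrableOn_Ioi (by simp)).2
        (integrableOn_Ioi_rpow_of_lt (by linarith) one_pos)
    rw [← integrable_indicator_iff measurableSet_Ioi]
    rw [← integrable_indicator_iff measurableSet_Ici] at h
    refine h.congr (Eventually.of_forall fun y => ?_)
    by_cases h0 : 0 < y
    · by_cases h1 : 1 ≤ y <;> simp [indicator, h0, h1, pow_finrank_sub_one_mul_rpow (E := E)]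
    · have h1 : ¬ 1 ≤ y := by linarith
      simp [indicator, h0, h1]
  rw [← integrable_indicator_iff (measurableSet_le measurable_const measurable_norm)]
  exact key

end NormPowers

lemma integrable_indicator_abs_rpow {a : ℝ} (ha : -1 < a) :
    Integrable (fun t : ℝ => {t : ℝ | |t| < 1}.indicator (fun t => |t| ^ a) t) := by
  have h := integrableOn_ball_norm_rpow (E := ℝ) volume (a := a) (by simpa using ha)
  rw [← integrable_indicator_iff (measurableSet_lt measurable_norm measurable_const)] at h
  exact h

lemma ae_coord_ne_zero (N : ℕ) :
    ∀ᵐ h : EuclideanSpace ℝ (Fin N), ∀ i, h i ≠ 0 := by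
  rw [ae_all_iff]
  intro i
  have h0 : ∀ᵐ x : Fin N → ℝ, x i ≠ 0 := by
    rw [ae_iff]
    simpa [volume_pi] using Measure.pi_hyperplane (fun _ : Fin N => (volume : Measure ℝ)) i 0
  exact (PiLp.volume_preserving_ofLp (Fin N)).quasiMeasurePreserving.ae h0

/-- Integrability near the origin of a power of the norm times a power of one coordinate. -/
lemma integrableOn_ball_norm_rpow_mul_coord_rpow {N : ℕ} (hN : 2 ≤ N) (i₀ : Fin N) {a g : ℝ}
    (ha : -1 < a) (hg : 0 ≤ g) (hga : g - a < N) :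
    IntegrableOn (fun h : EuclideanSpace ℝ (Fin N) => ‖h‖ ^ (-g) * |h i₀| ^ a)
      {h | ‖h‖ < 1} := by
  have hN1 : (0 : ℝ) < N - 1 := by
    have : (2 : ℝ) ≤ N := by exact_mod_cast hN
    linarith
  -- split `g = c + (N - 1) * d`
  obtain ⟨c, hc0, hcg, hca, hcd⟩ : ∃ c : ℝ, 0 ≤ c ∧ c ≤ g ∧ c - a < 1 ∧ g - c < N - 1 := by
    by_cases hgN : g < N - 1
    · exact ⟨0, le_rfl, hg, by linarith, by linarith⟩
    · push Not at hgN
      refine ⟨((g - (N - 1)) + min (1 + a) g) / 2, ?_, ?_, ?_, ?_⟩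
      all_goals
        rcases min_cases (1 + a) g with ⟨hm, _⟩ | ⟨hm, _⟩ <;> rw [hm] <;> linarith
  set d : ℝ := (g - c) / (N - 1) with hd
  have hd0 : 0 ≤ d := div_nonneg (by linarith) hN1.le
  have hd1 : d < 1 := by rw [hd, div_lt_one hN1]; exact hcd
  set b : Fin N → ℝ := fun i => if i = i₀ then a - c else -d with hb
  have hKer : Integrable (fun x : Fin N → ℝ =>
      ∏ i, {t : ℝ | |t| < 1}.indicator (fun t => |t| ^ b i) (x i)) := by
    refine Integrable.fintype_prod
      (f := fun i t => {t : ℝ | |t| < 1}.indicator (fun t => |t| ^ b i) t) fun i => ?_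
    refine integrable_indicator_abs_rpow ?_
    simp only [hb]
    split_ifs <;> linarith
  have hProd := (PiLp.volume_preserving_ofLp (Fin N)).integrable_comp_of_integrable hKer
  rw [← integrable_indicator_iff (measurableSet_lt measurable_norm measurable_const)]
  refine hProd.mono' ?_ ?_
  · refine Measurable.aestronglyMeasurable ?_
    refine Measurable.indicator ?_ (measurableSet_lt measurable_norm measurable_const)
    fun_prop
  filter_upwards [ae_coord_ne_zero N] with h hne
  have hrhs : 0 ≤ ∏ i, {t : ℝ | |t| < 1}.indicator (fun t => |t| ^ b i) (h i) :=
    Finset.prod_nonneg fun i _ => indicator_nonneg (fun t _ => by positivity) _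
  by_cases hh : ‖h‖ < 1
  swap
  · simpa [indicator, hh] using hrhs
  have hi : ∀ i, |h i| ≤ ‖h‖ := fun i => PiLp.norm_apply_le h i
  have hpos : 0 < ‖h‖ := (abs_pos.2 (hne i₀)).trans_le (hi i₀)
  have e1 : ∀ i, {t : ℝ | |t| < 1}.indicator (fun t => |t| ^ b i) (h i) = |h i| ^ b i := fun i =>
    indicator_of_mem (s := {t : ℝ | |t| < 1}) ((hi i).trans_lt hh) _
  rw [indicator_of_mem (show h ∈ {h | ‖h‖ < 1} from hh), Real.norm_of_nonneg (by positivity)]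
  simp only [Function.comp, e1]
  rw [← Finset.mul_prod_erase _ _ (Finset.mem_univ i₀)]
  have e2 : |h i₀| ^ b i₀ = |h i₀| ^ (-c) * |h i₀| ^ a := by
    simp only [hb, if_true]
    rw [← Real.rpow_add (abs_pos.2 (hne i₀))]
    ring_nf
  have e3 : ‖h‖ ^ (-g) = ‖h‖ ^ (-c) * ∏ i ∈ Finset.univ.erase i₀, ‖h‖ ^ (-d) := by
    rw [Finset.prod_const, Finset.card_erase_of_mem (Finset.mem_univ _), Finset.card_univ,
      Fintype.card_fin, ← Real.rpow_mul_natCast hpos.le, ← Real.rpow_add hpos,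
      Nat.cast_sub (by omega), Nat.cast_one]
    congr 1
    rw [hd]
    field_simp
    ring
  have e4 : ∏ i ∈ Finset.univ.erase i₀, ‖h‖ ^ (-d) ≤ ∏ i ∈ Finset.univ.erase i₀, |h i| ^ b i := by
    refine Finset.prod_le_prod (fun _ _ => by positivity) fun i hi' => ?_
    simp only [hb, if_neg (Finset.ne_of_mem_erase hi')]
    exact Real.rpow_le_rpow_of_nonpos (abs_pos.2 (hne i)) (hi i) (by linarith)
  have e5 : ‖h‖ ^ (-c) ≤ |h i₀| ^ (-c) :=
    Real.rpow_le_rpow_of_nonpos (abs_pos.2 (hne i₀)) (hi i₀) (by linarith)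
  rw [e2, e3]
  calc ‖h‖ ^ (-c) * (∏ i ∈ Finset.univ.erase i₀, ‖h‖ ^ (-d)) * |h i₀| ^ a
      ≤ |h i₀| ^ (-c) * (∏ i ∈ Finset.univ.erase i₀, |h i| ^ b i) * |h i₀| ^ a := by gcongr
    _ = _ := by ring

/-- The integrand of `(-Δ_p)^s (-‖·‖^b)` at a unit vector `e`, in the increment `h = y - e`. -/
noncomputable def pvKernel {N : ℕ} (s p b : ℝ) (e h : EuclideanSpace ℝ (Fin N)) : ℝ :=
  oddPow p (‖e + h‖ ^ b - 1) * ‖h‖ ^ (-((N : ℝ) + s * p))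

/-- The integrand obtained by linearizing `‖·‖^b` at the coordinate vector `e_{i₀}`. -/
noncomputable def linKernel {N : ℕ} (s p b : ℝ) (i₀ : Fin N) (h : EuclideanSpace ℝ (Fin N)) : ℝ :=
  oddPow p (b * h i₀) * ‖h‖ ^ (-((N : ℝ) + s * p))

@[fun_prop]
lemma measurable_pvKernel {N : ℕ} (s p b : ℝ) (e : EuclideanSpace ℝ (Fin N)) :
    Measurable (pvKernel s p b e) := by
  unfold pvKernel
  fun_prop

@[fun_prop]
lemma measurable_linKernel {N : ℕ} (s p b : ℝ) (i₀ : Fin N) :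
    Measurable (linKernel s p b i₀) := by
  unfold linKernel
  fun_prop

lemma linKernel_neg {N : ℕ} (s p b : ℝ) (i₀ : Fin N) (h : EuclideanSpace ℝ (Fin N)) :
    linKernel s p b i₀ (-h) = -linKernel s p b i₀ h := by
  simp [linKernel, oddPow_neg]

lemma abs_norm_add_rpow_sub_le {N : ℕ} {b : ℝ} (hb0 : 0 < b) (hb1 : b < 1) (i₀ : Fin N)
    {h : EuclideanSpace ℝ (Fin N)} (hh : ‖h‖ < 1) :
    |(‖EuclideanSpace.single i₀ (1 : ℝ) + h‖ ^ b - 1) - b * h i₀| ≤ 10 * ‖h‖ ^ 2 := by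
  set e := EuclideanSpace.single i₀ (1 : ℝ) with he
  have hsq : ‖e + h‖ ^ 2 = 1 + (2 * h i₀ + ‖h‖ ^ 2) := by
    rw [norm_add_sq_real, he, EuclideanSpace.inner_single_left]
    simp
    ring
  have hpos : 0 < ‖e + h‖ := by
    rw [norm_pos_iff]
    intro h0
    have : ‖h‖ = 1 := by
      rw [← neg_eq_of_add_eq_zero_right h0, norm_neg, he]
      simp
    linarith
  have hτ : -1 < 2 * h i₀ + ‖h‖ ^ 2 := by nlinarith
  have hpow : ‖e + h‖ ^ b = (1 + (2 * h i₀ + ‖h‖ ^ 2)) ^ (b / 2) := by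
    rw [← hsq, ← Real.rpow_natCast_mul hpos.le]
    congr 1
    push_cast
    ring
  have hT := abs_one_add_rpow_sub_le (b := b / 2) (by linarith) (by linarith) hτ
  rw [← hpow] at hT
  obtain ⟨hc1, hc2⟩ := abs_le.1 (show |h i₀| ≤ ‖h‖ from PiLp.norm_apply_le h i₀)
  have hn := norm_nonneg h
  have hτsq : (2 * h i₀ + ‖h‖ ^ 2) ^ 2 ≤ (3 * ‖h‖) ^ 2 := by
    apply sq_le_sq'
    · nlinarith
    · nlinarith
  obtain ⟨hT1, hT2⟩ := abs_le.1 hT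
  have := mul_nonneg hb0.le (sq_nonneg ‖h‖)
  have := mul_nonneg (sub_nonneg.2 hb1.le) (sq_nonneg ‖h‖)
  rw [abs_le]
  constructor <;> nlinarith

lemma integrableOn_compl_ball_pvKernel {N : ℕ} {s p b : ℝ} (hp : 1 < p) (hb0 : 0 < b)
    (hb1 : b < 1) (hbs : b * (p - 1) < s * p) (i₀ : Fin N) :
    IntegrableOn (pvKernel s p b (EuclideanSpace.single i₀ (1 : ℝ))) {h | 1 ≤ ‖h‖} := by
  have : Nonempty (Fin N) := ⟨i₀⟩
  have hI := (integrableOn_compl_ball_norm_rpow (E := EuclideanSpace ℝ (Fin N)) volume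
    (a := b * (p - 1) - (N + s * p)) (by simp; linarith)).const_mul (2 ^ (p - 1))
  refine hI.mono' (by fun_prop) ?_
  refine (ae_restrict_iff' (measurableSet_le measurable_const measurable_norm)).2
    (Eventually.of_forall fun h hh => ?_)
  have hh : 1 ≤ ‖h‖ := hh
  have hpos : 0 < ‖h‖ := by linarith
  have hle : |‖EuclideanSpace.single i₀ (1 : ℝ) + h‖ ^ b - 1| ≤ 2 * ‖h‖ ^ b := by
    have h1 : (1 : ℝ) ≤ ‖h‖ ^ b := Real.one_le_rpow hh hb0.le
    have h2 : ‖EuclideanSpace.single i₀ (1 : ℝ) + h‖ ≤ 2 * ‖h‖ := by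
      refine (norm_add_le _ _).trans ?_
      simp
      linarith
    have h3 : ‖EuclideanSpace.single i₀ (1 : ℝ) + h‖ ^ b ≤ 2 * ‖h‖ ^ b := by
      refine (Real.rpow_le_rpow (norm_nonneg _) h2 hb0.le).trans ?_
      rw [Real.mul_rpow (by norm_num) hpos.le]
      gcongr
      simpa using Real.rpow_le_rpow_of_exponent_le (by norm_num : (1 : ℝ) ≤ 2) hb1.le
    have h4 : 0 ≤ ‖EuclideanSpace.single i₀ (1 : ℝ) + h‖ ^ b := by positivity
    rw [abs_le]
    constructor <;> linarith
  unfold pvKernel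
  rw [norm_mul, Real.norm_eq_abs, abs_oddPow hp, Real.norm_of_nonneg (by positivity)]
  calc |‖EuclideanSpace.single i₀ (1 : ℝ) + h‖ ^ b - 1| ^ (p - 1) * ‖h‖ ^ (-((N : ℝ) + s * p))
      ≤ (2 * ‖h‖ ^ b) ^ (p - 1) * ‖h‖ ^ (-((N : ℝ) + s * p)) := by
        gcongr
    _ = 2 ^ (p - 1) * ‖h‖ ^ (b * (p - 1) - (N + s * p)) := by
        rw [Real.mul_rpow (by norm_num) (by positivity), ← Real.rpow_mul hpos.le, mul_assoc,
          ← Real.rpow_add hpos]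
        rfl

lemma integrableOn_ball_pvKernel_sub_linKernel {N : ℕ} (hN : 2 ≤ N) {s p b : ℝ} (hs : 0 < s)
    (hs1 : s < 1) (hp : 1 < p) (hb0 : 0 < b) (hb1 : b < 1) (i₀ : Fin N) :
    IntegrableOn (fun h => pvKernel s p b (EuclideanSpace.single i₀ (1 : ℝ)) h
      - linKernel s p b i₀ h) {h | ‖h‖ < 1} := by
  have : Nonempty (Fin N) := ⟨i₀⟩
  have hN2 : (2 : ℝ) ≤ N := by exact_mod_cast hN
  have hsp0 : 0 < s * p := by positivity
  have hsp : s * p < p := by nlinarith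
  have hmeas : MeasurableSet {h : EuclideanSpace ℝ (Fin N) | ‖h‖ < 1} :=
    measurableSet_lt measurable_norm measurable_const
  rcases le_total 2 p with hp2 | hp2
  · have hI := (integrableOn_ball_norm_rpow (E := EuclideanSpace ℝ (Fin N)) volume
      (a := p - (N + s * p)) (by simp; linarith)).const_mul ((p - 1) * 10 * 11 ^ (p - 2))
    refine hI.mono' (by fun_prop) ((ae_restrict_iff' hmeas).2 ?_)
    filter_upwards [ae_coord_ne_zero N] with h hne hh
    have hh : ‖h‖ < 1 := hh
    have hT := abs_norm_add_rpow_sub_le hb0 hb1 i₀ hh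
    have hi : |h i₀| ≤ ‖h‖ := PiLp.norm_apply_le h i₀
    have hpos : 0 < ‖h‖ := (abs_pos.2 (hne i₀)).trans_le hi
    have hB : |b * h i₀| ≤ 11 * ‖h‖ := by
      rw [abs_mul, abs_of_pos hb0]
      nlinarith
    have hA : |‖EuclideanSpace.single i₀ (1 : ℝ) + h‖ ^ b - 1| ≤ 11 * ‖h‖ := by
      have h1 : |b * h i₀| ≤ ‖h‖ := by
        rw [abs_mul, abs_of_pos hb0]
        nlinarith [abs_nonneg (h i₀)]
      have h2 := abs_sub_abs_le_abs_sub (‖EuclideanSpace.single i₀ (1 : ℝ) + h‖ ^ b - 1) (b * h i₀)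
      nlinarith
    have hJ := abs_oddPow_sub_le_of_two_le hp2 hA hB
    unfold pvKernel linKernel
    rw [← sub_mul, norm_mul, Real.norm_eq_abs, Real.norm_of_nonneg (by positivity)]
    calc _ ≤ ((p - 1) * (10 * ‖h‖ ^ 2) * (11 * ‖h‖) ^ (p - 2)) * ‖h‖ ^ (-((N : ℝ) + s * p)) := by
          refine mul_le_mul_of_nonneg_right (hJ.trans ?_) (by positivity)
          gcongr
      _ = (p - 1) * 10 * 11 ^ (p - 2) * (‖h‖ ^ (2 : ℝ) * ‖h‖ ^ (p - 2)
            * ‖h‖ ^ (-((N : ℝ) + s * p))) := by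
          rw [Real.mul_rpow (by norm_num) hpos.le, Real.rpow_two]
          ring
      _ = _ := by
          rw [← Real.rpow_add hpos, ← Real.rpow_add hpos]
          ring_nf
  · have hI := (integrableOn_ball_norm_rpow_mul_coord_rpow hN i₀ (a := p - 2)
      (g := N + s * p - 2) (by linarith) (by linarith)
      (by linarith)).const_mul (20 * b ^ (p - 2))
    refine hI.mono' (by fun_prop) ((ae_restrict_iff' hmeas).2 ?_)
    filter_upwards [ae_coord_ne_zero N] with h hne hh
    have hh : ‖h‖ < 1 := hh
    have hT := abs_norm_add_rpow_sub_le hb0 hb1 i₀ hh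
    have hi : |h i₀| ≤ ‖h‖ := PiLp.norm_apply_le h i₀
    have hpos : 0 < ‖h‖ := (abs_pos.2 (hne i₀)).trans_le hi
    have hJ := abs_oddPow_sub_le hp hp2 (‖EuclideanSpace.single i₀ (1 : ℝ) + h‖ ^ b - 1)
      (mul_ne_zero hb0.ne' (hne i₀))
    unfold pvKernel linKernel
    rw [← sub_mul, norm_mul, Real.norm_eq_abs, Real.norm_of_nonneg (by positivity)]
    calc _ ≤ (2 * (10 * ‖h‖ ^ 2) * |b * h i₀| ^ (p - 2)) * ‖h‖ ^ (-((N : ℝ) + s * p)) := by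
          refine mul_le_mul_of_nonneg_right (hJ.trans ?_) (by positivity)
          gcongr
      _ = 20 * b ^ (p - 2) * ((‖h‖ ^ (2 : ℝ) * ‖h‖ ^ (-((N : ℝ) + s * p)))
            * |h i₀| ^ (p - 2)) := by
          rw [abs_mul, abs_of_pos hb0, Real.mul_rpow hb0.le (abs_nonneg _), Real.rpow_two]
          ring
      _ = _ := by
          rw [← Real.rpow_add hpos]
          ring_nf

lemma integrableOn_annulus_linKernel {N : ℕ} {s p b : ℝ} (hs : 0 < s) (hp : 1 < p)
    (hb0 : 0 < b) (hb1 : b < 1) (i₀ : Fin N) {r : ℝ} (hr : 0 < r) :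
    IntegrableOn (linKernel s p b i₀) {h | r < ‖h‖ ∧ ‖h‖ < 1} := by
  have hfin : volume {h : EuclideanSpace ℝ (Fin N) | r < ‖h‖ ∧ ‖h‖ < 1} < ⊤ := by
    refine (measure_mono ?_).trans_lt
      (measure_ball_lt_top (x := (0 : EuclideanSpace ℝ (Fin N))) (r := 1))
    intro h hh
    simpa using hh.2
  refine Measure.integrableOn_of_bounded (M := r ^ (-((N : ℝ) + s * p))) hfin.ne (by fun_prop) ?_
  refine (ae_restrict_iff' ((measurableSet_lt measurable_const measurable_norm).inter
    (measurableSet_lt measurable_norm measurable_const))).2 (Eventually.of_forall fun h hh => ?_)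
  obtain ⟨h1, h2⟩ : r < ‖h‖ ∧ ‖h‖ < 1 := hh
  have hi : |h i₀| ≤ ‖h‖ := PiLp.norm_apply_le h i₀
  unfold linKernel
  rw [norm_mul, Real.norm_eq_abs, abs_oddPow hp, Real.norm_of_nonneg (by positivity)]
  have h3 : |b * h i₀| ^ (p - 1) ≤ 1 := by
    refine Real.rpow_le_one (abs_nonneg _) ?_ (by linarith)
    rw [abs_mul, abs_of_pos hb0]
    nlinarith [abs_nonneg (h i₀)]
  have h4 : ‖h‖ ^ (-((N : ℝ) + s * p)) ≤ r ^ (-((N : ℝ) + s * p)) :=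
    Real.rpow_le_rpow_of_nonpos hr h1.le (by
      have : 0 < s * p := by positivity
      have : (0 : ℝ) ≤ N := by positivity
      linarith)
  calc _ ≤ 1 * r ^ (-((N : ℝ) + s * p)) := by gcongr
    _ = _ := one_mul _

lemma integral_annulus_linKernel {N : ℕ} (s p b : ℝ) (i₀ : Fin N) (r : ℝ) :
    ∫ h in {h | r < ‖h‖ ∧ ‖h‖ < 1}, linKernel s p b i₀ h = 0 := by
  have hmeas : MeasurableSet {h : EuclideanSpace ℝ (Fin N) | r < ‖h‖ ∧ ‖h‖ < 1} :=
    (measurableSet_lt measurable_const measurable_norm).inter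
      (measurableSet_lt measurable_norm measurable_const)
  rw [← integral_indicator hmeas]
  have h1 := integral_neg_eq_self ({h | r < ‖h‖ ∧ ‖h‖ < 1}.indicator (linKernel s p b i₀)) volume
  have h2 : ∀ h, {h | r < ‖h‖ ∧ ‖h‖ < 1}.indicator (linKernel s p b i₀) (-h)
      = -{h | r < ‖h‖ ∧ ‖h‖ < 1}.indicator (linKernel s p b i₀) h := by
    intro h
    by_cases hh : r < ‖h‖ ∧ ‖h‖ < 1 <;> simp [indicator, hh, linKernel_neg]
  simp only [h2, integral_neg] at h1
  linarith

/-- Existence of the principal value at a coordinate vector. -/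
lemma exists_tendsto_pvKernel {N : ℕ} (hN : 2 ≤ N) {s p b : ℝ} (hs : 0 < s)
    (hs1 : s < 1) (hp : 1 < p) (hb0 : 0 < b) (hb1 : b < 1) (hbs : b * (p - 1) < s * p)
    (i₀ : Fin N) :
    (∀ r : ℝ, 0 < r →
      IntegrableOn (pvKernel s p b (EuclideanSpace.single i₀ (1 : ℝ))) {h | r < ‖h‖}) ∧
    ∃ L : ℝ, Tendsto (fun r : ℝ =>
      ∫ h in {h | r < ‖h‖}, pvKernel s p b (EuclideanSpace.single i₀ (1 : ℝ)) h)
      (nhdsWithin 0 (Ioi 0)) (nhds L) := by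
  set K := pvKernel s p b (EuclideanSpace.single i₀ (1 : ℝ)) with hK
  set B : Set (EuclideanSpace ℝ (Fin N)) := {h | ‖h‖ < 1} with hB
  have hBm : MeasurableSet B := measurableSet_lt measurable_norm measurable_const
  have hrm : ∀ r : ℝ, MeasurableSet {h : EuclideanSpace ℝ (Fin N) | r < ‖h‖} := fun r =>
    measurableSet_lt measurable_const measurable_norm
  set l := B.indicator (linKernel s p b i₀) with hl
  have hD : Integrable (fun h => K h - l h) := by
    rw [← integrableOn_univ, ← union_compl_self B]
    refine IntegrableOn.union ?_ ?_
    · refine (integrableOn_ball_pvKernel_sub_linKernel hN hs hs1 hp hb0 hb1 i₀).congr_fun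
        (fun h hh => ?_) hBm
      rw [hl, indicator_of_mem hh]
    · have hc : Bᶜ = {h | 1 ≤ ‖h‖} := by ext; simp [hB]
      refine IntegrableOn.congr_fun (f := K) ?_ (fun h hh => ?_) hBm.compl
      · rw [hc]
        exact integrableOn_compl_ball_pvKernel hp hb0 hb1 hbs i₀
      · simp [hl, indicator_of_notMem hh]
  have hlint : ∀ r : ℝ, 0 < r → IntegrableOn l {h | r < ‖h‖} := fun r hr => by
    rw [hl, IntegrableOn, integrable_indicator_iff hBm, IntegrableOn, Measure.restrict_restrict hBm,
      inter_comm]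
    exact integrableOn_annulus_linKernel hs hp hb0 hb1 i₀ hr
  have hl0 : ∀ r : ℝ, ∫ h in {h | r < ‖h‖}, l h = 0 := fun r => by
    rw [hl, integral_indicator hBm, Measure.restrict_restrict hBm, inter_comm]
    exact integral_annulus_linKernel s p b i₀ r
  have hKint : ∀ r : ℝ, 0 < r → IntegrableOn K {h | r < ‖h‖} := fun r hr => by
    refine (hD.integrableOn.add (hlint r hr)).congr (Eventually.of_forall fun h => ?_)
    simp
  refine ⟨hKint, ∫ h, K h - l h, ?_⟩
  have hcov : AECover (volume : Measure (EuclideanSpace ℝ (Fin N))) (nhdsWithin 0 (Ioi (0 : ℝ)))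
      (fun r : ℝ => {h | r < ‖h‖}) := by
    refine ⟨?_, hrm⟩
    filter_upwards [ae_coord_ne_zero N] with h hne
    have hpos : 0 < ‖h‖ := (abs_pos.2 (hne i₀)).trans_le (PiLp.norm_apply_le h i₀)
    exact nhdsWithin_le_nhds (eventually_lt_nhds hpos)
  refine (hcov.integral_tendsto_of_countably_generated hD).congr' ?_
  filter_upwards [self_mem_nhdsWithin] with r hr
  rw [integral_sub (hKint r hr) (hlint r hr), hl0, sub_zero]

/-- Scaling and rotation: the principal value at `c • R e` in terms of that at the unit
vector `e`. -/
lemma pvFracPLap_smul_isometry {N : ℕ} {s p b ε c L : ℝ} (hp : 1 < p) (hε : 0 < ε) (hc : 0 < c)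
    (e : EuclideanSpace ℝ (Fin N)) (he : ‖e‖ = 1)
    (R : EuclideanSpace ℝ (Fin N) ≃ₗᵢ[ℝ] EuclideanSpace ℝ (Fin N))
    (hKer : ∀ r : ℝ, 0 < r → IntegrableOn (pvKernel s p b e) {h | r < ‖h‖})
    (hlim : Tendsto (fun r : ℝ => ∫ h in {h | r < ‖h‖}, pvKernel s p b e h)
      (nhdsWithin 0 (Ioi 0)) (nhds L)) :
    pvFracPLap N s p (fun y => -ε * ‖y‖ ^ b) (c • R e)
      (ε ^ (p - 1) * c ^ (b * (p - 1) - s * p) * L) := by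
  set x := c • R e with hx
  set A : ℝ := ε ^ (p - 1) * c ^ (b * (p - 1) - (N + s * p)) with hA
  set F : EuclideanSpace ℝ (Fin N) → ℝ := fun y =>
    |(-ε * ‖x‖ ^ b) - (-ε * ‖y‖ ^ b)| ^ (p - 2) * ((-ε * ‖x‖ ^ b) - (-ε * ‖y‖ ^ b))
      * ‖x - y‖ ^ (-((N : ℝ) + s * p)) with hF
  have hSm : ∀ r : ℝ, MeasurableSet {y : EuclideanSpace ℝ (Fin N) | r < ‖x - y‖} := fun r =>
    measurableSet_lt measurable_const (by fun_prop)
  have hhm : ∀ r : ℝ, MeasurableSet {h : EuclideanSpace ℝ (Fin N) | r < ‖h‖} := fun r =>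
    measurableSet_lt measurable_const measurable_norm
  set T : EuclideanSpace ℝ (Fin N) → EuclideanSpace ℝ (Fin N) := fun y =>
    R.symm (c⁻¹ • (y - x)) with hT
  have hyT : ∀ y, y = c • R (e + T y) := fun y => by
    simp [hT, hx, smul_smul, hc.ne']
  have hnormT : ∀ y, ‖T y‖ = ‖x - y‖ / c := fun y => by
    rw [hT, LinearIsometryEquiv.norm_map, norm_smul, norm_inv, Real.norm_of_nonneg hc.le,
      norm_sub_rev]
    ring
  have hnormx : ‖x‖ = c := by
    rw [hx, norm_smul, LinearIsometryEquiv.norm_map, he, Real.norm_of_nonneg hc.le, mul_one]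
  have hFT : ∀ y, F y = A * pvKernel s p b e (T y) := fun y => by
    have hny : ‖y‖ = c * ‖e + T y‖ := by
      conv_lhs => rw [hyT y]
      rw [norm_smul, LinearIsometryEquiv.norm_map, Real.norm_of_nonneg hc.le]
    have hxy : ‖x - y‖ = c * ‖T y‖ := by
      rw [hnormT]; field_simp
    have hd : (-ε * ‖x‖ ^ b) - (-ε * ‖y‖ ^ b) = (ε * c ^ b) * (‖e + T y‖ ^ b - 1) := by
      rw [hnormx, hny, Real.mul_rpow hc.le (norm_nonneg _)]
      ring
    have hF' : F y = oddPow p ((-ε * ‖x‖ ^ b) - (-ε * ‖y‖ ^ b))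
      * ‖x - y‖ ^ (-((N : ℝ) + s * p)) := rfl
    rw [hF', hd, oddPow_mul, hxy, Real.mul_rpow hc.le (norm_nonneg _),
      oddPow_of_nonneg hp (by positivity), Real.mul_rpow hε.le (by positivity),
      ← Real.rpow_mul hc.le, hA, sub_eq_add_neg (b * (p - 1)), Real.rpow_add hc, pvKernel]
    ring
  have hind : ∀ r : ℝ, {y | r < ‖x - y‖}.indicator F = fun y =>
      A * ({h | r / c < ‖h‖}.indicator (pvKernel s p b e)) (T y) := fun r => by
    funext y
    have hiff : r / c < ‖T y‖ ↔ r < ‖x - y‖ := by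
      rw [hnormT, div_lt_div_iff_of_pos_right hc]
    by_cases hy : r < ‖x - y‖
    · rw [indicator_of_mem (s := {y | r < ‖x - y‖}) hy,
        indicator_of_mem (s := {h | r / c < ‖h‖}) (hiff.2 hy), hFT]
    · rw [indicator_of_notMem (s := {y | r < ‖x - y‖}) hy,
        indicator_of_notMem (s := {h | r / c < ‖h‖}) (fun h => hy (hiff.1 h)), mul_zero]
  have hComp : ∀ G : EuclideanSpace ℝ (Fin N) → ℝ, Integrable G →
      Integrable fun y => G (T y) := fun G hG =>
    ((R.symm.measurePreserving.integrable_comp_of_integrable hG).comp_smul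
      (inv_ne_zero hc.ne')).comp_sub_right x
  have hval : ∀ G : EuclideanSpace ℝ (Fin N) → ℝ, ∫ y, G (T y) = c ^ N * ∫ h, G h := fun G => by
    have h1 := integral_sub_right_eq_self (μ := volume) (fun z => G (R.symm (c⁻¹ • z))) x
    have h2 := Measure.integral_comp_smul (volume : Measure (EuclideanSpace ℝ (Fin N)))
      (fun z => G (R.symm z)) c⁻¹
    have h3 := R.symm.measurePreserving.integral_comp
      R.symm.toHomeomorph.measurableEmbedding G
    have h4 : |((c⁻¹ ^ Module.finrank ℝ (EuclideanSpace ℝ (Fin N))))⁻¹| = c ^ N := by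
      rw [finrank_euclideanSpace_fin, inv_pow, inv_inv, abs_of_pos (by positivity)]
    rw [h1, h2, h3, h4, smul_eq_mul]
  refine ⟨fun r hr => ?_, ?_⟩
  · change IntegrableOn F _ _
    rw [← integrable_indicator_iff (hSm r), hind]
    exact (hComp _ ((integrable_indicator_iff (hhm _)).2 (hKer _ (div_pos hr hc)))).const_mul A
  · change Tendsto (fun r : ℝ => ∫ y in {y | r < ‖x - y‖}, F y) _ _
    have heq : (fun r : ℝ => ∫ y in {y | r < ‖x - y‖}, F y) = fun r =>
        ε ^ (p - 1) * c ^ (b * (p - 1) - s * p) *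
          ∫ h in {h | r / c < ‖h‖}, pvKernel s p b e h := by
      funext r
      have hcN : c ^ (b * (p - 1) - s * p) = c ^ (b * (p - 1) - (N + s * p)) * c ^ N := by
        rw [← Real.rpow_natCast c N, ← Real.rpow_add hc]
        ring_nf
      rw [← integral_indicator (hSm r), hind, integral_const_mul, hval,
        integral_indicator (hhm _), hA, hcN]
      ring
    rw [heq]
    refine Tendsto.const_mul _ (hlim.comp ?_)
    refine tendsto_nhdsWithin_iff.2 ⟨?_, ?_⟩
    · have : Tendsto (fun r : ℝ => r / c) (nhds 0) (nhds (0 / c)) := tendsto_id.div_const c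
      rw [zero_div] at this
      exact this.mono_left nhdsWithin_le_nhds
    · filter_upwards [self_mem_nhdsWithin] with r hr
      exact div_pos hr hc

lemma exists_isometry_smul_eq {E : Type*} [NormedAddCommGroup E] [InnerProductSpace ℝ E]
    {e x : E} (he : ‖e‖ = 1) (hx : x ≠ 0) : ∃ R : E ≃ₗᵢ[ℝ] E, ‖x‖ • R e = x := by
  have hx' : ‖x‖ ≠ 0 := norm_ne_zero_iff.2 hx
  have h : ‖e‖ = ‖‖x‖⁻¹ • x‖ := by
    rw [norm_smul, norm_inv, norm_norm, inv_mul_cancel₀ hx', he]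
  refine ⟨(ℝ ∙ (e - ‖x‖⁻¹ • x))ᗮ.reflection, ?_⟩
  rw [Submodule.reflection_sub h, smul_smul, mul_inv_cancel₀ hx', one_smul]

/-- The functions `φ_ε(x) = -ε|x|^{θ̄}` are strict subsolutions at infinity:
for every `κ > 0` there is `r_κ ≥ 1` such that for all `ε ∈ (0,1)` and `|x| ≥ r_κ`,
`(-Δ_p)^s φ_ε (x)` exists with a value strictly below
`κ |x|^{-tθ} (ε θ̄ |x|^{θ̄-1})^m`. -/
theorem stmt_14 (N : ℕ) (hN : 2 ≤ N) (s p t m : ℝ)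
    (hs : 0 < s) (hs1 : s < 1) (hp : 1 < p)
    (hNsp : s * p < N)
    (ht : 0 ≤ t) (hm : 0 ≤ m) (hmp : m ≤ p - 1)
    (θ θb : ℝ) (hθ : 0 < θ)
    (hθb0 : 0 < θb) (hθb1 : θb < min (s * p / (p - 1)) 1)
    (hkey : (θb - 1) * (p - 1 - m) + p - 1 - s * p + t * θ < 0) :
    ∀ κ : ℝ, 0 < κ → ∃ rκ : ℝ, 1 ≤ rκ ∧
      ∀ ε : ℝ, 0 < ε → ε < 1 →
        ∀ x : EuclideanSpace ℝ (Fin N), rκ ≤ ‖x‖ →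
          ∃ L : ℝ, pvFracPLap N s p (fun y => -ε * ‖y‖ ^ θb) x L ∧
            L < κ * ‖x‖ ^ (-(t * θ)) * (ε * θb * ‖x‖ ^ (θb - 1)) ^ m := by
  intro κ hκ
  obtain ⟨hθ1, hθ2⟩ := lt_min_iff.1 hθb1
  rw [lt_div_iff₀ (by linarith)] at hθ1
  obtain ⟨hKer, L, hL⟩ := exists_tendsto_pvKernel hN hs hs1 hp hθb0 hθ2 hθ1
    (⟨0, by omega⟩ : Fin N)
  set e := EuclideanSpace.single (⟨0, by omega⟩ : Fin N) (1 : ℝ) with he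
  have he1 : ‖e‖ = 1 := by simp [he]
  set η : ℝ := (θb - 1) * (p - 1 - m) + p - 1 - s * p + t * θ with hη
  have hsmall : ∀ᶠ ρ : ℝ in atTop, |L| * ρ ^ η < κ * θb ^ m := by
    have h0 := (tendsto_rpow_neg_atTop (neg_pos.2 hkey)).const_mul |L|
    rw [neg_neg, mul_zero] at h0
    exact h0.eventually_lt_const (by positivity)
  obtain ⟨r₀, hr₀⟩ := eventually_atTop.1 hsmall
  refine ⟨max 1 r₀, le_max_left _ _, fun ε hε hε1 x hx => ?_⟩
  have hx1 : 1 ≤ ‖x‖ := (le_max_left _ _).trans hx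
  have hpos : 0 < ‖x‖ := by linarith
  obtain ⟨R, hR⟩ := exists_isometry_smul_eq he1 (norm_pos_iff.1 hpos)
  have hpv := pvFracPLap_smul_isometry hp hε hpos e he1 R hKer hL
  rw [hR] at hpv
  refine ⟨_, hpv, ?_⟩
  have hεm : ε ^ (p - 1) ≤ ε ^ m := Real.rpow_le_rpow_of_exponent_ge hε hε1.le hmp
  set q : ℝ := -(t * θ) + (θb - 1) * m with hq
  have hsplit : ‖x‖ ^ (θb * (p - 1) - s * p) = ‖x‖ ^ η * ‖x‖ ^ q := by
    rw [← Real.rpow_add hpos, hη, hq]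
    ring_nf
  have hrhs : κ * ‖x‖ ^ (-(t * θ)) * (ε * θb * ‖x‖ ^ (θb - 1)) ^ m
      = (ε ^ m * ‖x‖ ^ q) * (κ * θb ^ m) := by
    rw [Real.mul_rpow (by positivity) (by positivity), Real.mul_rpow hε.le hθb0.le,
      ← Real.rpow_mul hpos.le, hq, Real.rpow_add hpos]
    ring
  rw [hrhs, hsplit]
  calc ε ^ (p - 1) * (‖x‖ ^ η * ‖x‖ ^ q) * L
      ≤ ε ^ (p - 1) * (‖x‖ ^ η * ‖x‖ ^ q) * |L| := by
        gcongr
        exact le_abs_self L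
    _ ≤ ε ^ m * (‖x‖ ^ η * ‖x‖ ^ q) * |L| := by gcongr
    _ = (ε ^ m * ‖x‖ ^ q) * (|L| * ‖x‖ ^ η) := by ring
    _ < (ε ^ m * ‖x‖ ^ q) * (κ * θb ^ m) :=
        mul_lt_mul_of_pos_left (hr₀ _ ((le_max_right _ _).trans hx)) (by positivity)
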